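/- Assume ε₁ = ε₂ = 1 and ε₃ = −1. (a) If (S₁, S₂, S₃) is a para-hypersymplectic structure on (E, B, b), then the quadruple (T₁, T₂, T₃, G), where T_i := ε_{i−1}·S_{i−1} ∘ S_{i+1} (indices modulo 3) and G := S₃ ∘ S₂ ∘ S₁, is a para-hyperkähler structure on (E, B, b), and S_i = ε_i ε_{i−1}·G ∘ T_i for i = 1, 2, 3 (explicitly, S₁ = −G ∘ T₁, S₂ = G ∘ T₂, S₃ = −G ∘ T₃). (b) Conversely, if (T₁, T₂, T₃, G) is a para-hyperkähler structure on (E, B, b), then setting S₁ := −G ∘ T₁, S₂ := G ∘ T₂ and S₃ := −G ∘ T₃ yields a para-hypersymplectic structure (S₁, S₂, S₃) on (E, B, b). -/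

import Mathlib

variable {E : Type*} [AddCommGroup E] [Module ℝ E]

/-- The deformed bracket `b_I(X,Y) = b(I X, Y) + b(X, I Y) - I (b(X,Y))`. -/
noncomputable def deform (b : E →ₗ[ℝ] E →ₗ[ℝ] E) (I : E →ₗ[ℝ] E) :
    E →ₗ[ℝ] E →ₗ[ℝ] E :=
  b ∘ₗ I + LinearMap.compl₂ b I - LinearMap.compr₂ b I

/-- The Nijenhuis torsion of `I` with respect to `b`:
`T_b I (X,Y) = b(I X, I Y) - I (b_I(X,Y))`. -/
noncomputable def torsion (b : E →ₗ[ℝ] E →ₗ[ℝ] E) (I : E →ₗ[ℝ] E) (X Y : E) : E :=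
  b (I X) (I Y) - I (deform b I X Y)

/-- The concomitant `C_b(I,J)(X,Y) = b_{I,J}(X,Y) + b_{J,I}(X,Y)`. -/
noncomputable def concomitant (b : E →ₗ[ℝ] E →ₗ[ℝ] E) (I J : E →ₗ[ℝ] E) (X Y : E) : E :=
  deform (deform b I) J X Y + deform (deform b J) I X Y

/-- An ε-hypersymplectic structure on `(E, B, b)`: a triple `S i` (indices in `ZMod 3`,
with `3 ≡ 0`) of `B`-skew-symmetric endomorphisms such that `S i ∘ S i = ε i • id`,
`S i ∘ S j = ε₁ε₂ε₃ • (S j ∘ S i)` for `i ≠ j`, and `b_{S i, S i} = ε i • b`. -/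
noncomputable def IsEpsHypersymplectic (B : E →ₗ[ℝ] E →ₗ[ℝ] ℝ) (b : E →ₗ[ℝ] E →ₗ[ℝ] E)
    (ε : ZMod 3 → ℝ) (S : ZMod 3 → E →ₗ[ℝ] E) : Prop :=
  (∀ i, ∀ X Y : E, B (S i X) Y = - B X (S i Y)) ∧
  (∀ i, S i ∘ₗ S i = ε i • (LinearMap.id : E →ₗ[ℝ] E)) ∧
  (∀ i j, i ≠ j → S i ∘ₗ S j = (ε 0 * ε 1 * ε 2) • (S j ∘ₗ S i)) ∧
  (∀ i, deform (deform b (S i)) (S i) = ε i • b)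

/-- The transition endomorphisms `T i := ε (i-1) • (S (i-1) ∘ S (i+1))`. -/
noncomputable def transMor (ε : ZMod 3 → ℝ) (S : ZMod 3 → E →ₗ[ℝ] E) (i : ZMod 3) :
    E →ₗ[ℝ] E :=
  ε (i - 1) • (S (i - 1) ∘ₗ S (i + 1))

/-- The endomorphism `G := S₃ ∘ S₂ ∘ S₁` (with `S₃ = S 0`). -/
noncomputable def metricG (S : ZMod 3 → E →ₗ[ℝ] E) : E →ₗ[ℝ] E :=
  S 0 ∘ₗ S 2 ∘ₗ S 1


/-- A para-hyperkähler structure `(T₁, T₂, T₃, G)` on `(E, B, b)`: `G` is a pseudo-metric,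
`T₁, T₂` are anti-commuting `B`-skew-symmetric para-complex structures, `T₃ = T₁ ∘ T₂`,
`(T₁, G)` and `(T₂, G)` satisfy the para-hermitian-pair compatibility, and the
endomorphisms `G ∘ Tⱼ` have vanishing Nijenhuis torsion, `j = 1, 2, 3`. -/
noncomputable def IsParaHyperkahler (B : E →ₗ[ℝ] E →ₗ[ℝ] ℝ) (b : E →ₗ[ℝ] E →ₗ[ℝ] E)
    (T1 T2 T3 G : E →ₗ[ℝ] E) : Prop :=
  (∀ X Y : E, B (G X) Y = B X (G Y)) ∧
  G ∘ₗ G = (LinearMap.id : E →ₗ[ℝ] E) ∧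
  (∀ X Y : E, B (T1 X) Y = - B X (T1 Y)) ∧
  (∀ X Y : E, B (T2 X) Y = - B X (T2 Y)) ∧
  T1 ∘ₗ T1 = (LinearMap.id : E →ₗ[ℝ] E) ∧
  T2 ∘ₗ T2 = (LinearMap.id : E →ₗ[ℝ] E) ∧
  (∀ X Y : E, torsion b T1 X Y = 0) ∧
  (∀ X Y : E, torsion b T2 X Y = 0) ∧
  T1 ∘ₗ T2 = -(T2 ∘ₗ T1) ∧
  T3 = T1 ∘ₗ T2 ∧
  (∀ X Y : E, B (G (T1 X)) (T1 Y) = - B (G X) Y) ∧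
  (∀ X Y : E, B (G (T2 X)) (T2 Y) = - B (G X) Y) ∧
  (∀ X Y : E, torsion b (G ∘ₗ T1) X Y = 0) ∧
  (∀ X Y : E, torsion b (G ∘ₗ T2) X Y = 0) ∧
  (∀ X Y : E, torsion b (G ∘ₗ T3) X Y = 0)

theorem deform_apply (b : E →ₗ[ℝ] E →ₗ[ℝ] E) (I : E →ₗ[ℝ] E) (X Y : E) :
    deform b I X Y = b (I X) Y + b X (I Y) - I (b X Y) := rfl

theorem torsion_apply (b : E →ₗ[ℝ] E →ₗ[ℝ] E) (I : E →ₗ[ℝ] E) (X Y : E) :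
    torsion b I X Y = b (I X) (I Y) - I (b (I X) Y) - I (b X (I Y)) + I (I (b X Y)) := by
  simp only [torsion, deform_apply, map_add, map_sub]
  abel

theorem torsion_smul (b : E →ₗ[ℝ] E →ₗ[ℝ] E) (c : ℝ) (I : E →ₗ[ℝ] E) (X Y : E) :
    torsion b (c • I) X Y = c ^ 2 • torsion b I X Y := by
  simp only [torsion_apply, LinearMap.smul_apply, map_smul]
  module

theorem torsion_neg (b : E →ₗ[ℝ] E →ₗ[ℝ] E) (I : E →ₗ[ℝ] E) (X Y : E) :
    torsion b (-I) X Y = torsion b I X Y := by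
  rw [← neg_one_smul ℝ I, torsion_smul]
  norm_num

/-- If `I² = c`, then `b_{I,I} = c b + 2 T_b I`. -/
theorem deform_deform_self (b : E →ₗ[ℝ] E →ₗ[ℝ] E) {I : E →ₗ[ℝ] E} {c : ℝ}
    (hI : ∀ X, I (I X) = c • X) (X Y : E) :
    deform (deform b I) I X Y = c • b X Y + (2 : ℝ) • torsion b I X Y := by
  simp only [torsion_apply, deform_apply, map_add, map_sub, hI, map_smul, LinearMap.smul_apply]
  module

theorem deform_deform_self_eq_smul_iff (b : E →ₗ[ℝ] E →ₗ[ℝ] E) {I : E →ₗ[ℝ] E} {c : ℝ}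
    (hI : ∀ X, I (I X) = c • X) :
    deform (deform b I) I = c • b ↔ ∀ X Y, torsion b I X Y = 0 := by
  constructor
  · intro h X Y
    have h' := deform_deform_self b hI X Y
    rw [h] at h'
    simpa using h'
  · intro h
    ext X Y
    simp [deform_deform_self b hI, h]

/-- The torsion of a product of two anti-commuting endomorphisms with scalar squares, in terms
of the torsions of the factors. -/
theorem two_smul_torsion_comp (b : E →ₗ[ℝ] E →ₗ[ℝ] E) {I J : E →ₗ[ℝ] E} {c d : ℝ}
    (hI : ∀ X, I (I X) = c • X) (hJ : ∀ X, J (J X) = d • X) (hJI : ∀ X, J (I X) = -I (J X))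
    (X Y : E) :
    (2 : ℝ) • torsion b (I ∘ₗ J) X Y =
      torsion b I (J X) (J Y) - J (torsion b I (J X) Y) - J (torsion b I X (J Y))
        - d • torsion b I X Y
      + (torsion b J (I X) (I Y) - I (torsion b J (I X) Y) - I (torsion b J X (I Y))
        - c • torsion b J X Y) := by
  simp only [torsion_apply, LinearMap.comp_apply, map_add, map_sub, map_neg, map_smul, hI, hJ, hJI,
    LinearMap.neg_apply]
  module

theorem torsion_comp_eq_zero (b : E →ₗ[ℝ] E →ₗ[ℝ] E) {I J : E →ₗ[ℝ] E} {c d : ℝ}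
    (hI : ∀ X, I (I X) = c • X) (hJ : ∀ X, J (J X) = d • X) (hJI : ∀ X, J (I X) = -I (J X))
    (hTI : ∀ X Y, torsion b I X Y = 0) (hTJ : ∀ X Y, torsion b J X Y = 0) (X Y : E) :
    torsion b (I ∘ₗ J) X Y = 0 := by
  have h := two_smul_torsion_comp b hI hJ hJI X Y
  simpa [hTI, hTJ] using h

theorem forall_zmod_three {p : ZMod 3 → Prop} : (∀ i, p i) ↔ p 1 ∧ p 2 ∧ p 0 := by
  refine ⟨fun h => ⟨h 1, h 2, h 0⟩, fun ⟨h1, h2, h0⟩ i => ?_⟩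
  have hi : i = 0 ∨ i = 1 ∨ i = 2 := by revert i; decide
  rcases hi with rfl | rfl | rfl <;> assumption

/-- A para-hermitian pair commutes. -/
theorem comm_of_skew_of_compat {B : E →ₗ[ℝ] E →ₗ[ℝ] ℝ}
    (hB : ∀ X : E, (∀ Y : E, B X Y = 0) → X = 0) {G T : E →ₗ[ℝ] E}
    (hT : ∀ X Y, B (T X) Y = -B X (T Y)) (hTT : ∀ X, T (T X) = X)
    (hGT : ∀ X Y, B (G (T X)) (T Y) = -B (G X) Y) (X : E) : T (G X) = G (T X) := by
  have h : T (G (T (T X))) - G (T X) = 0 := hB _ fun Y => by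
    have h1 := hT (G (T (T X))) Y
    have h2 := hGT (T X) Y
    simp only [map_sub, LinearMap.sub_apply]
    linarith
  rwa [hTT, sub_eq_zero] at h

theorem statement15 (B : E →ₗ[ℝ] E →ₗ[ℝ] ℝ) (b : E →ₗ[ℝ] E →ₗ[ℝ] E)
    (hBsymm : ∀ X Y : E, B X Y = B Y X)
    (hBnd : ∀ X : E, (∀ Y : E, B X Y = 0) → X = 0)
    (ε : ZMod 3 → ℝ) (hε1 : ε 1 = 1) (hε2 : ε 2 = 1) (hε3 : ε 0 = -1) :
    (∀ S : ZMod 3 → E →ₗ[ℝ] E,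
      IsEpsHypersymplectic B b ε S →
        IsParaHyperkahler B b (transMor ε S 1) (transMor ε S 2)
          (transMor ε S 0) (metricG S) ∧
        (∀ i, S i = (ε i * ε (i - 1)) • (metricG S ∘ₗ transMor ε S i)) ∧
        S 1 = -(metricG S ∘ₗ transMor ε S 1) ∧
        S 2 = metricG S ∘ₗ transMor ε S 2 ∧
        S 0 = -(metricG S ∘ₗ transMor ε S 0)) ∧
    (∀ T1 T2 T3 G : E →ₗ[ℝ] E,
      IsParaHyperkahler B b T1 T2 T3 G →
        IsEpsHypersymplectic B b ε
          (fun i => if i = 1 then -(G ∘ₗ T1) else if i = 2 then G ∘ₗ T2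
            else -(G ∘ₗ T3))) := by
  constructor
  · rintro S ⟨hskew, hsq, hanti, hdef⟩
    have hsq' (i : ZMod 3) (X : E) : S i (S i X) = ε i • X := by
      simpa using LinearMap.congr_fun (hsq i) X
    have htor (i : ZMod 3) : ∀ X Y, torsion b (S i) X Y = 0 :=
      (deform_deform_self_eq_smul_iff b (hsq' i)).1 (hdef i)
    have hanti' (i j : ZMod 3) (hij : i ≠ j) (X : E) : S i (S j X) = -S j (S i X) := by
      simpa [hε1, hε2, hε3] using LinearMap.congr_fun (hanti i j hij) X
    have h10 := hanti' 1 0 (by decide)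
    have h20 := hanti' 2 0 (by decide)
    have h21 := hanti' 2 1 (by decide)
    have h00 (X : E) : S 0 (S 0 X) = -X := by simp [hsq', hε3]
    have h11 (X : E) : S 1 (S 1 X) = X := by simp [hsq', hε1]
    have h22 (X : E) : S 2 (S 2 X) = X := by simp [hsq', hε2]
    have hT1 : transMor ε S 1 = -(S 0 ∘ₗ S 2) := by
      have h : (1 + 1 : ZMod 3) = 2 := by decide
      simp [transMor, h, hε3]
    have hT2 : transMor ε S 2 = S 1 ∘ₗ S 0 := by
      have h : (2 + 1 : ZMod 3) = 0 := by decide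
      have h' : (2 - 1 : ZMod 3) = 1 := by decide
      simp only [transMor, h, h', hε1, one_smul]
    have hT0 : transMor ε S 0 = S 2 ∘ₗ S 1 := by
      have h : (0 - 1 : ZMod 3) = 2 := by decide
      simp only [transMor, h, zero_add, hε2, one_smul]
    have hG1 : metricG S ∘ₗ transMor ε S 1 = -S 1 := by
      ext X; simp [metricG, hT1, h10, h20, h21, h00, h22]
    have hG2 : metricG S ∘ₗ transMor ε S 2 = S 2 := by
      ext X; simp [metricG, hT2, h10, h20, h00, h11]
    have hG0 : metricG S ∘ₗ transMor ε S 0 = -S 0 := by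
      ext X; simp [metricG, hT0, h21, h11, h22]
    refine ⟨⟨?_, ?_, ?_, ?_, ?_, ?_, ?_, ?_, ?_, ?_, ?_, ?_, ?_, ?_, ?_⟩, ?_, ?_, ?_, ?_⟩
    · intro X Y
      simp [metricG, hskew, h10, h20, h21]
    · ext X
      simp [metricG, h10, h20, h21, h00, h11, h22]
    · intro X Y
      simp [hT1, hskew, h20]
    · intro X Y
      simp [hT2, hskew, h10]
    · ext X
      simp [hT1, h20, h00, h22]
    · ext X
      simp [hT2, h10, h00, h11]
    · intro X Y
      rw [hT1, torsion_neg]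
      exact torsion_comp_eq_zero b (hsq' 0) (hsq' 2) h20 (htor 0) (htor 2) X Y
    · rw [hT2]
      exact torsion_comp_eq_zero b (hsq' 1) (hsq' 0) (hanti' 0 1 (by decide)) (htor 1) (htor 0)
    · ext X
      simp [hT1, hT2, h10, h20, h21, h00]
    · ext X
      simp [hT0, hT1, hT2, h10, h20, h21, h00]
    · intro X Y
      simp [metricG, hT1, hskew, h10, h20, h21, h00, h22]
    · intro X Y
      simp [metricG, hT2, hskew, h10, h20, h21, h00, h11]
    · intro X Y
      rw [hG1, torsion_neg, htor]
    · intro X Y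
      rw [hG2, htor]
    · intro X Y
      rw [hG0, torsion_neg, htor]
    · have h : (2 - 1 : ZMod 3) = 1 := by decide
      have h' : (0 - 1 : ZMod 3) = 2 := by decide
      rw [forall_zmod_three, hG1, hG2, hG0, h, h', sub_self, hε1, hε2, hε3]
      simp
    · rw [hG1, neg_neg]
    · rw [hG2]
    · rw [hG0, neg_neg]
  · rintro T1 T2 T3 G ⟨hG, hGG, hs1, hs2, h11, h22, -, -, h12, rfl, hc1, hc2, ht1, ht2, ht3⟩
    replace hGG (X : E) : G (G X) = X := LinearMap.congr_fun hGG X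
    replace h11 (X : E) : T1 (T1 X) = X := LinearMap.congr_fun h11 X
    replace h22 (X : E) : T2 (T2 X) = X := LinearMap.congr_fun h22 X
    have h21 (X : E) : T2 (T1 X) = -T1 (T2 X) := by
      rw [← LinearMap.comp_apply T1, h12]; simp
    have hg1 := comm_of_skew_of_compat hBnd hs1 h11 hc1
    have hg2 := comm_of_skew_of_compat hBnd hs2 h22 hc2
    have h21' : (2 : ZMod 3) ≠ 1 := by decide
    have h02' : (0 : ZMod 3) ≠ 2 := by decide
    have hsq : ∀ i X, (fun i : ZMod 3 => if i = 1 then -(G ∘ₗ T1) else if i = 2 then G ∘ₗ T2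
        else -(G ∘ₗ T1 ∘ₗ T2)) i ((fun i : ZMod 3 => if i = 1 then -(G ∘ₗ T1) else
        if i = 2 then G ∘ₗ T2 else -(G ∘ₗ T1 ∘ₗ T2)) i X) = ε i • X := by
      rw [forall_zmod_three]
      simp [h21', h02', hε1, hε2, hε3, hg1, hg2, hGG, h11, h22, h21]
    refine ⟨?_, fun i => LinearMap.ext (hsq i), ?_, fun i =>
      (deform_deform_self_eq_smul_iff b (hsq i)).2 ?_⟩
    · rw [forall_zmod_three]
      simp [h21', h02', hG, hs1, hs2, hg1, hg2, h21]
    · simp only [forall_zmod_three, hε1, hε2, hε3]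
      simp [h21', h02', h02'.symm, LinearMap.ext_iff, hg1, hg2, hGG, h11, h22, h21]
    · revert i
      rw [forall_zmod_three]
      simp [h21', h02', torsion_neg, ht1, ht2, ht3]
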